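/- For every prime p and every natural number n, the number of transfer systems for the cyclic group C_{p^n} of order p^n equals the (n+1)-st Catalan number Catalan(n+1) = (1/(n+2))·binom(2n+2, n+1). -/

import Mathlib

/-- A transfer system for a finite group `G`. -/
def IsTransferSystem {G : Type*} [Group G] (T : Set (Subgroup G × Subgroup G)) : Prop :=
  (∀ p ∈ T, p.1 ≤ p.2) ∧
  (∀ H : Subgroup G, (H, H) ∈ T) ∧
  (∀ H K L : Subgroup G, (H, K) ∈ T → (K, L) ∈ T → (H, L) ∈ T) ∧
  (∀ H K : Subgroup G, (H, K) ∈ T → ∀ g : G,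
    (Subgroup.map (MulAut.conj g).toMonoidHom H, Subgroup.map (MulAut.conj g).toMonoidHom K) ∈ T) ∧
  (∀ H K L : Subgroup G, (H, K) ∈ T → L ≤ K → (H ⊓ L, L) ∈ T)

/-- A relation on the chain `0 < 1 < ⋯ < m - 1` which is a transfer system for the lattice
structure of the chain. -/
structure IsChainTransferSystem (m : ℕ) (R : ℕ → ℕ → Prop) : Prop where
  le_and_lt : ∀ {i j}, R i j → i ≤ j ∧ j < m
  refl : ∀ {i}, i < m → R i i
  trans : ∀ {i j k}, R i j → R j k → R i k
  restrict : ∀ {i j k}, R i k → i ≤ j → j ≤ k → R i j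

/-- The ordinal-sum relation on `1 + a + b` points built from a relation `A` on `a` points and a
relation `B` on `b` points, where the new least point `0` is related exactly to itself and to the
`a` points carrying `A`. -/
def chainGlue (a : ℕ) (A B : ℕ → ℕ → Prop) (i j : ℕ) : Prop :=
  (i = 0 ∧ j ≤ a) ∨ (1 ≤ i ∧ 1 ≤ j ∧ A (i - 1) (j - 1)) ∨
    (a + 1 ≤ i ∧ a + 1 ≤ j ∧ B (i - (a + 1)) (j - (a + 1)))

namespace IsChainTransferSystem

theorem glue {a b : ℕ} {A B : ℕ → ℕ → Prop} (hA : IsChainTransferSystem a A)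
    (hB : IsChainTransferSystem b B) : IsChainTransferSystem (a + b + 1) (chainGlue a A B) where
  le_and_lt := by
    rintro i j (h | ⟨h1, h2, h⟩ | ⟨h1, h2, h⟩)
    · omega
    · have := hA.le_and_lt h
      omega
    · have := hB.le_and_lt h
      omega
  refl := by
    intro i hi
    rcases Nat.eq_zero_or_pos i with h | h
    · exact Or.inl ⟨h, by omega⟩
    · rcases Nat.lt_or_ge a i with h' | h'
      · exact Or.inr (Or.inr ⟨h', h', hB.refl (by omega)⟩)
      · exact Or.inr (Or.inl ⟨h, h, hA.refl (by omega)⟩)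
  trans := by
    rintro i j k (h | ⟨h1, h2, h⟩ | ⟨h1, h2, h⟩) (h' | ⟨h1', h2', h'⟩ | ⟨h1', h2', h'⟩)
    · exact Or.inl ⟨h.1, h'.2⟩
    · have := hA.le_and_lt h'
      exact Or.inl ⟨h.1, by omega⟩
    · omega
    · omega
    · exact Or.inr (Or.inl ⟨h1, h2', hA.trans h h'⟩)
    · have := hA.le_and_lt h
      omega
    · omega
    · have := hA.le_and_lt h'
      omega
    · exact Or.inr (Or.inr ⟨h1, h2', hB.trans h h'⟩)
  restrict := by
    rintro i j k (h | ⟨h1, h2, h⟩ | ⟨h1, h2, h⟩) hij hjk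
    · exact Or.inl ⟨h.1, by omega⟩
    · exact Or.inr (Or.inl ⟨h1, by omega, hA.restrict h (by omega) (by omega)⟩)
    · exact Or.inr (Or.inr ⟨h1, by omega, hB.restrict h (by omega) (by omega)⟩)

theorem _root_.chainGlue_zero_iff {a : ℕ} {A B : ℕ → ℕ → Prop} {j : ℕ} :
    chainGlue a A B 0 j ↔ j ≤ a := by
  simp [chainGlue]

theorem chainGlue_left_iff {a : ℕ} {A B : ℕ → ℕ → Prop} (hA : IsChainTransferSystem a A)
    {i j : ℕ} : chainGlue a A B (i + 1) (j + 1) ∧ j < a ↔ A i j := by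
  constructor
  · rintro ⟨h | ⟨h1, h2, h⟩ | ⟨h1, h2, h⟩, hj⟩
    · omega
    · exact h
    · omega
  · exact fun h => ⟨Or.inr (Or.inl ⟨by omega, by omega, h⟩), (hA.le_and_lt h).2⟩

theorem chainGlue_right_iff {a : ℕ} {A B : ℕ → ℕ → Prop} (hA : IsChainTransferSystem a A)
    {i j : ℕ} : chainGlue a A B (i + (a + 1)) (j + (a + 1)) ↔ B i j := by
  constructor
  · rintro (h | ⟨h1, h2, h⟩ | ⟨h1, h2, h⟩)
    · omega
    · have := hA.le_and_lt h
      omega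
    · simpa using h
  · exact fun h => Or.inr (Or.inr ⟨by omega, by omega, by simpa using h⟩)

theorem exists_eq_chainGlue {m : ℕ} {R : ℕ → ℕ → Prop} (hR : IsChainTransferSystem (m + 1) R) :
    ∃ a ≤ m, ∃ A B, IsChainTransferSystem a A ∧ IsChainTransferSystem (m - a) B ∧
      chainGlue a A B = R := by
  classical
  obtain ⟨a, ha, hmax⟩ : ∃ a, R 0 a ∧ ∀ j, R 0 j → j ≤ a := by
    refine ⟨Nat.findGreatest (R 0) m,
      Nat.findGreatest_spec (P := R 0) (Nat.zero_le m) (hR.refl (by omega)), fun j hj => ?_⟩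
    exact Nat.le_findGreatest (by have := hR.le_and_lt hj; omega) hj
  have ham := (hR.le_and_lt ha).2
  refine ⟨a, by omega, fun i j => R (i + 1) (j + 1) ∧ j < a,
    fun i j => R (i + (a + 1)) (j + (a + 1)), ⟨?_, ?_, ?_, ?_⟩, ⟨?_, ?_, ?_, ?_⟩, ?_⟩
  · rintro i j ⟨h, hj⟩
    have := hR.le_and_lt h
    omega
  · exact fun {i} hi => ⟨hR.refl (by omega), hi⟩
  · exact fun h h' => ⟨hR.trans h.1 h'.1, h'.2⟩
  · exact fun h hij hjk => ⟨hR.restrict h.1 (by omega) (by omega), by omega⟩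
  · intro i j h
    have := hR.le_and_lt h
    omega
  · exact fun {i} hi => hR.refl (by omega)
  · exact fun h h' => hR.trans h h'
  · exact fun h hij hjk => hR.restrict h (by omega) (by omega)
  · ext i j
    constructor
    · rintro (⟨rfl, h⟩ | ⟨h1, h2, h⟩ | ⟨h1, h2, h⟩)
      · exact hR.restrict ha (Nat.zero_le _) h
      · simpa [Nat.sub_add_cancel h1, Nat.sub_add_cancel h2] using h.1
      · simpa [Nat.sub_add_cancel h1, Nat.sub_add_cancel h2] using h
    · intro h
      have hij := hR.le_and_lt h
      rcases Nat.eq_zero_or_pos i with rfl | hi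
      · exact Or.inl ⟨rfl, hmax j h⟩
      · rcases Nat.lt_or_ge a i with hai | hai
        · refine Or.inr (Or.inr ⟨hai, by omega, ?_⟩)
          simpa [Nat.sub_add_cancel hai, Nat.sub_add_cancel (hai.trans_le hij.1)] using h
        · have := hmax j (hR.trans (hR.restrict ha (Nat.zero_le _) hai) h)
          refine Or.inr (Or.inl ⟨hi, by omega, ?_, by omega⟩)
          rwa [Nat.sub_add_cancel hi, Nat.sub_add_cancel (by omega)]

/-- Gluing, as a map between the types of transfer systems on chains. -/
def glueMap (m : ℕ)
    (x : Σ a : Fin (m + 1), {A // IsChainTransferSystem a A} ×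
      {B // IsChainTransferSystem (m - a) B}) :
    {R // IsChainTransferSystem (m + 1) R} :=
  ⟨chainGlue x.1 x.2.1.1 x.2.2.1, by
    have h := x.2.1.2.glue x.2.2.2
    rwa [Nat.add_sub_cancel' (Nat.lt_succ_iff.mp x.1.2)] at h⟩

theorem glueMap_bijective (m : ℕ) : Function.Bijective (glueMap m) := by
  constructor
  · rintro ⟨a, ⟨A, hA⟩, ⟨B, hB⟩⟩ ⟨a', ⟨A', hA'⟩, ⟨B', hB'⟩⟩ h
    have h : chainGlue a A B = chainGlue a' A' B' := congrArg Subtype.val h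
    obtain rfl : a = a' := by
      have h0 (j : ℕ) : j ≤ (a : ℕ) ↔ j ≤ (a' : ℕ) := by
        rw [← chainGlue_zero_iff (A := A) (B := B), h, chainGlue_zero_iff]
      exact Fin.ext (le_antisymm ((h0 _).1 le_rfl) ((h0 _).2 le_rfl))
    obtain rfl : A = A' := by
      ext i j
      rw [← chainGlue_left_iff (B := B) hA, h, chainGlue_left_iff hA']
    obtain rfl : B = B' := by
      ext i j
      rw [← chainGlue_right_iff (B := B) hA, h, chainGlue_right_iff hA]
    rfl
  · rintro ⟨R, hR⟩
    obtain ⟨a, ha, A, B, hA, hB, h⟩ := hR.exists_eq_chainGlue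
    exact ⟨⟨⟨a, Nat.lt_succ_of_le ha⟩, ⟨A, hA⟩, ⟨B, hB⟩⟩, Subtype.ext h⟩

theorem finite_and_card_eq_catalan (m : ℕ) :
    Finite {R // IsChainTransferSystem m R} ∧
      Nat.card {R // IsChainTransferSystem m R} = catalan m := by
  induction m using Nat.strong_induction_on with
  | _ m ih =>
    cases m with
    | zero =>
      have : Unique {R // IsChainTransferSystem 0 R} :=
        { default := ⟨fun _ _ => False, by constructor <;> simp⟩
          uniq := by
            rintro ⟨R, hR⟩
            ext i j
            simpa using fun h => Nat.not_lt_zero _ (hR.le_and_lt h).2 }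
      exact ⟨inferInstance, by simp⟩
    | succ m =>
      have (a : Fin (m + 1)) : Finite {A // IsChainTransferSystem a A} := (ih a a.2).1
      have (a : Fin (m + 1)) : Finite {B // IsChainTransferSystem (m - a) B} :=
        (ih (m - a) (by omega)).1
      refine ⟨Finite.of_surjective _ (glueMap_bijective m).2, ?_⟩
      rw [← Nat.card_eq_of_bijective _ (glueMap_bijective m), Nat.card_sigma, catalan_succ]
      refine Finset.sum_congr rfl fun a _ => ?_
      rw [Nat.card_prod, (ih a a.2).2, (ih (m - a) (by omega)).2]

end IsChainTransferSystem

/-- If the subgroups of a commutative group form a finite chain, its transfer systems are those of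
that chain. -/
def transferSystemEquivChain {G : Type*} [CommGroup G] {m : ℕ} (e : Fin m ≃o Subgroup G) :
    {T : Set (Subgroup G × Subgroup G) // IsTransferSystem T} ≃
      {R // IsChainTransferSystem m R} where
  toFun T := ⟨fun i j => ∃ (hi : i < m) (hj : j < m), (e ⟨i, hi⟩, e ⟨j, hj⟩) ∈ T.1, by
    obtain ⟨T, hle, hrefl, htrans, -, hres⟩ := T
    refine ⟨?_, fun hi => ⟨hi, hi, hrefl _⟩, ?_, ?_⟩
    · rintro i j ⟨hi, hj, h⟩
      exact ⟨by simpa using hle _ h, hj⟩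
    · rintro i j k ⟨hi, hj, h⟩ ⟨_, hk, h'⟩
      exact ⟨hi, hk, htrans _ _ _ h h'⟩
    · rintro i j k ⟨hi, hk, h⟩ hij hjk
      have hj : j < m := by omega
      refine ⟨hi, hj, ?_⟩
      have := hres _ _ (e ⟨j, hj⟩) h (by simpa using hjk)
      rwa [inf_eq_left.mpr (by simpa using hij)] at this⟩
  invFun R := ⟨{q | R.1 (e.symm q.1) (e.symm q.2)}, by
    obtain ⟨R, hR⟩ := R
    refine ⟨fun q hq => ?_, fun H => hR.refl (e.symm H).2, fun _ _ _ => hR.trans,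
      fun H K h g => ?_, fun H K L h hL => ?_⟩
    · exact e.symm.le_iff_le.mp (hR.le_and_lt hq).1
    · have hg : (MulAut.conj g).toMonoidHom = MonoidHom.id G := by
        ext x
        simp
      rw [Set.mem_ofPred_eq, hg, Subgroup.map_id, Subgroup.map_id]
      exact h
    · change R (e.symm (H ⊓ L)) (e.symm L)
      rcases le_total (e.symm H) (e.symm L) with hHL | hHL
      · rw [inf_eq_left.mpr (e.symm.le_iff_le.mp hHL)]
        exact hR.restrict h hHL (e.symm.monotone hL)
      · rw [inf_eq_right.mpr (e.symm.le_iff_le.mp hHL)]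
        exact hR.refl (e.symm L).2⟩
  left_inv T := by
    ext ⟨H, K⟩
    simp
  right_inv R := by
    obtain ⟨R, hR⟩ := R
    ext i j
    suffices i < m ∧ j < m ∧ R i j ↔ R i j by simpa [and_left_comm] using this
    exact ⟨fun h => h.2.2, fun h => ⟨(hR.le_and_lt h).1.trans_lt (hR.le_and_lt h).2, (hR.le_and_lt h).2, h⟩⟩

/-- The subgroups of a cyclic group of order `p ^ n` form a chain with `n + 1` elements. -/
theorem IsCyclic.nonempty_orderIso_subgroup_of_card_eq_prime_pow {G : Type*} [CommGroup G]
    [IsCyclic G] {p n : ℕ} (hp : p.Prime) (hG : Nat.card G = p ^ n) :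
    Nonempty (Fin (n + 1) ≃o Subgroup G) := by
  have : Finite G := Nat.finite_of_card_ne_zero (by rw [hG]; exact pow_ne_zero _ hp.ne_zero)
  let S (k : Fin (n + 1)) : Subgroup G := (powMonoidHom (p ^ (k : ℕ)) : G →* G).ker
  have hS (k : Fin (n + 1)) : Nat.card (S k) = p ^ (k : ℕ) := by
    rw [IsCyclic.card_powMonoidHom_ker, hG,
      Nat.gcd_eq_right (pow_dvd_pow p (Nat.lt_succ_iff.mp k.2))]
  have hle (i j : Fin (n + 1)) : S i ≤ S j ↔ i ≤ j := by
    constructor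
    · intro h
      have := Subgroup.card_dvd_of_le h
      rwa [hS, hS, Nat.pow_dvd_pow_iff_le_right hp.one_lt] at this
    · intro h x hx
      obtain ⟨c, hc⟩ := pow_dvd_pow p (show (i : ℕ) ≤ j from h)
      have hx : x ^ p ^ (i : ℕ) = 1 := hx
      change x ^ p ^ (j : ℕ) = 1
      rw [hc, pow_mul, hx, one_pow]
  refine ⟨RelIso.ofSurjective (OrderEmbedding.ofMapLEIff S hle) fun H => ?_⟩
  obtain ⟨k, hk, hH⟩ := (Nat.dvd_prime_pow hp).mp (hG ▸ H.card_subgroup_dvd_card)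
  refine ⟨⟨k, Nat.lt_succ_of_le hk⟩, (Subgroup.eq_of_le_of_card_ge (fun x hx => ?_) ?_).symm⟩
  · change x ^ p ^ k = 1
    rw [← hH]
    exact congrArg Subtype.val (pow_card_eq_one' (x := (⟨x, hx⟩ : H)))
  · exact ((hS _).trans hH.symm).le

/-- The number of transfer systems for the cyclic group `C_{p^n}` is the
`(n+1)`-st Catalan number. -/
theorem card_transferSystems_cyclic_prime_pow (p n : ℕ) (hp : p.Prime) :
    Nat.card {T : Set (Subgroup (Multiplicative (ZMod (p ^ n))) ×
        Subgroup (Multiplicative (ZMod (p ^ n)))) // IsTransferSystem T} =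
      catalan (n + 1) := by
  have hcard : Nat.card (Multiplicative (ZMod (p ^ n))) = p ^ n :=
    Nat.card_zmod _
  obtain ⟨e⟩ := IsCyclic.nonempty_orderIso_subgroup_of_card_eq_prime_pow hp hcard
  rw [Nat.card_congr (transferSystemEquivChain e)]
  exact (IsChainTransferSystem.finite_and_card_eq_catalan (n + 1)).2
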